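/- Let C be a finite nonempty type of classes, y ∈ C, s : C → ℝ, k : C → ℝ with k c ≥ 0 for all c, and τ > 0. Assume Σ_{j≠y} k j · exp(s j / τ) > 0. Then for every c ≠ y, the ratio of the absolute value of the partial derivative of L_PCR at coordinate c to the absolute value of the partial derivative of L_PCR at coordinate y equals r(c) := k c · exp(s c / τ) / Σ_{j≠y} k j · exp(s j / τ). -/

import Mathlib

theorem hasDerivAt_update_apply {C : Type*} [DecidableEq C] (s : C → ℝ) (c j : C) (x : ℝ) :
    HasDerivAt (fun t : ℝ => Function.update s c t j) (if j = c then 1 else 0) x := by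
  by_cases h : j = c
  · subst h
    simpa using hasDerivAt_id' x
  · simpa [h] using hasDerivAt_const x (s j)

/-- The partial derivatives of the PCR loss, valid whenever the normalizer is nonzero. -/
theorem hasDerivAt_pcr_loss {C : Type*} [Fintype C] [DecidableEq C]
    (y c : C) (s k : C → ℝ) (τ : ℝ) (hZ : ∑ j : C, k j * Real.exp (s j / τ) ≠ 0) :
    HasDerivAt (fun t : ℝ =>
        -Real.log (Real.exp (Function.update s c t y / τ) /
          ∑ j : C, k j * Real.exp (Function.update s c t j / τ)))
      ((k c * Real.exp (s c / τ) / (∑ j : C, k j * Real.exp (s j / τ)) -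
        if y = c then 1 else 0) / τ) (s c) := by
  have hexp (j : C) := ((hasDerivAt_update_apply s c j (s c)).div_const τ).exp
  have hsum := HasDerivAt.fun_sum (u := Finset.univ) fun j _ => (hexp j).const_mul (k j)
  simp only [Function.update_eq_self] at hexp hsum
  have hval : ∑ j : C, k j * (Real.exp (s j / τ) * ((if j = c then 1 else 0) / τ)) =
      k c * Real.exp (s c / τ) / τ := by
    rw [Finset.sum_eq_single c (fun j _ hj => by simp [hj]) (by simp)]
    simp only [if_true]
    ring
  rw [hval] at hsum
  have hlog := (((hexp y).fun_div hsum (by simpa using hZ)).log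
    (by simpa using hZ)).fun_neg
  refine hlog.congr_deriv ?_
  simp only [Function.update_eq_self]
  have hy := Real.exp_ne_zero (s y / τ)
  generalize (∑ j : C, k j * Real.exp (s j / τ)) = Z at hZ ⊢
  field_simp
  ring


/-- **Relative penalty as a gradient ratio.** If `Σ_{j ≠ y} k j * exp (s j / τ) > 0`,
then for every `c ≠ y`, the ratio of the absolute value of the partial derivative of the
PCR loss at coordinate `c` to the one at coordinate `y` equals
`r(c) = k c * exp (s c / τ) / Σ_{j ≠ y} k j * exp (s j / τ)`. -/
theorem pcr_relative_penalty {C : Type*} [Fintype C] [Nonempty C] [DecidableEq C]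
    (y : C) (s k : C → ℝ) (hk : ∀ c, 0 ≤ k c) (τ : ℝ) (hτ : 0 < τ)
    (hsumy : 0 < ∑ j ∈ Finset.univ.erase y, k j * Real.exp (s j / τ)) :
    ∀ c : C, c ≠ y →
      |deriv (fun t : ℝ =>
          -Real.log (Real.exp (Function.update s c t y / τ) /
            ∑ j : C, k j * Real.exp (Function.update s c t j / τ))) (s c)| /
      |deriv (fun t : ℝ =>
          -Real.log (Real.exp (Function.update s y t y / τ) /
            ∑ j : C, k j * Real.exp (Function.update s y t j / τ))) (s y)| =
      k c * Real.exp (s c / τ) /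
        ∑ j ∈ Finset.univ.erase y, k j * Real.exp (s j / τ) := by
  intro c hc
  have hsplit := Finset.add_sum_erase Finset.univ (fun j => k j * Real.exp (s j / τ))
    (Finset.mem_univ y)
  have hy : 0 ≤ k y * Real.exp (s y / τ) := mul_nonneg (hk y) (Real.exp_pos _).le
  have hc₀ : 0 ≤ k c * Real.exp (s c / τ) := mul_nonneg (hk c) (Real.exp_pos _).le
  have hZ : 0 < ∑ j : C, k j * Real.exp (s j / τ) := by
    rw [← hsplit]
    positivity
  rw [(hasDerivAt_pcr_loss y c s k τ hZ.ne').deriv, (hasDerivAt_pcr_loss y y s k τ hZ.ne').deriv,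
    if_neg hc.symm, if_pos rfl, sub_zero, div_sub_one hZ.ne', ← hsplit, sub_add_cancel_left]
  rw [← hsplit] at hZ
  rw [neg_div, neg_div, abs_neg, abs_of_nonneg (by positivity), abs_of_nonneg (by positivity)]
  field_simp
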